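/- Let κ > 0 and 0 < t₀ < 1/κ²; set δ = κ√t₀ and q₀(x) = (1 − δ) · p_{t₀}((1 − δ) x). Then ∫_{−1}^{1} (1/2) · log( (1/2) / q₀(x) ) dx ≤ 1/(3 t₀ (1 − δ)) + log(√t₀/(1 − δ)) + log(2√(2π)); in particular, the Kullback–Leibler divergence of the uniform density on [−1, 1] from the density q₀ of the absolutely continuous part of the terminal distribution of the smoothed denoising flow started from p_{t₀} is finite and bounded by this quantity. -/

import Mathlib

open MeasureTheory Real Set

/-- Centered Gaussian density with standard deviation `σ`. -/
noncomputable def gaussD (x σ : ℝ) : ℝ :=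
  (Real.sqrt (2 * Real.pi) * σ)⁻¹ * Real.exp (-x ^ 2 / (2 * σ ^ 2))

/-- Noised empirical density for the training set `{-1, +1}`. -/
noncomputable def pTwo (t x : ℝ) : ℝ :=
  (1 / 2) * (gaussD (x + 1) (Real.sqrt t) + gaussD (x - 1) (Real.sqrt t))

theorem gaussD_pos (x : ℝ) {σ : ℝ} (hσ : 0 < σ) : 0 < gaussD x σ := by
  unfold gaussD
  positivity

theorem pTwo_pos {t : ℝ} (ht : 0 < t) (x : ℝ) : 0 < pTwo t x := by
  have h := Real.sqrt_pos.2 ht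
  have h₁ := gaussD_pos (x + 1) h
  have h₂ := gaussD_pos (x - 1) h
  unfold pTwo
  positivity

theorem continuous_pTwo (t : ℝ) : Continuous (pTwo t) := by
  unfold pTwo gaussD
  fun_prop

theorem gaussD_lower {t y e : ℝ} (ht : 0 < t) (h : y ^ 2 ≤ e) :
    (Real.sqrt (2 * Real.pi) * Real.sqrt t)⁻¹ * Real.exp (-(e / (2 * t))) ≤
      gaussD y (Real.sqrt t) := by
  unfold gaussD
  rw [Real.sq_sqrt ht.le, neg_div]
  gcongr

theorem pTwo_lower {t a x : ℝ} (ht : 0 < t) (ha : 0 < a) (hx : x ∈ Set.Icc (-1 : ℝ) 1) :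
    (1 / 2) * ((Real.sqrt (2 * Real.pi) * Real.sqrt t)⁻¹ *
      Real.exp (-((1 + (a ^ 2 - 2 * a) * x ^ 2) / (2 * t)))) ≤ pTwo t (a * x) := by
  have h := Real.sqrt_pos.2 ht
  have h₁ := gaussD_pos (a * x + 1) h
  have h₂ := gaussD_pos (a * x - 1) h
  obtain ⟨hl, hu⟩ := hx
  unfold pTwo
  rcases le_total 0 x with h0 | h0
  · have key : (a * x - 1) ^ 2 ≤ 1 + (a ^ 2 - 2 * a) * x ^ 2 := by
      nlinarith [mul_nonneg ha.le (mul_nonneg h0 (sub_nonneg.2 hu))]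
    linarith [gaussD_lower ht key]
  · have key : (a * x + 1) ^ 2 ≤ 1 + (a ^ 2 - 2 * a) * x ^ 2 := by
      nlinarith [mul_nonneg ha.le (mul_nonneg (neg_nonneg.2 h0) (by linarith : 0 ≤ x + 1))]
    linarith [gaussD_lower ht key]

theorem log_ratio_le {t a x : ℝ} (ht : 0 < t) (ha : 0 < a) (hx : x ∈ Set.Icc (-1 : ℝ) 1) :
    Real.log ((1 / 2) / (a * pTwo t (a * x))) ≤
      Real.log (Real.sqrt (2 * Real.pi)) + Real.log (Real.sqrt t / a) +
        (1 + (a ^ 2 - 2 * a) * x ^ 2) / (2 * t) := by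
  have hs := Real.sqrt_pos.2 ht
  have hc : 0 < Real.sqrt (2 * Real.pi) := by positivity
  have hp := pTwo_pos ht (a * x)
  rw [← Real.log_mul hc.ne' (by positivity), ← Real.log_exp ((1 + _) / (2 * t)),
    ← Real.log_mul (by positivity) (by positivity)]
  apply Real.log_le_log (by positivity)
  rw [div_le_iff₀ (by positivity)]
  have h := pTwo_lower ht ha hx
  set E := (1 + (a ^ 2 - 2 * a) * x ^ 2) / (2 * t)
  calc (1 / 2 : ℝ) = Real.sqrt (2 * Real.pi) * (Real.sqrt t / a) * Real.exp E *
        (a * ((1 / 2) * ((Real.sqrt (2 * Real.pi) * Real.sqrt t)⁻¹ * Real.exp (-E)))) := by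
        rw [Real.exp_neg]
        field_simp
    _ ≤ _ := by gcongr

/-- KL-divergence bound for the terminal interpolating density
`q₀(x) = (1-δ) p_{t₀}((1-δ)x)` with `δ = κ√t₀`:
`KL(u₁ ‖ q₀) ≤ 1/(3t₀(1-δ)) + log(√t₀/(1-δ)) + log(2√(2π))`. -/
theorem stmt_16 (κ : ℝ) (hκ : 0 < κ) (t₀ : ℝ) (ht₀ : t₀ ∈ Set.Ioo 0 (1 / κ ^ 2)) :
    (∫ x in Set.Icc (-1 : ℝ) 1,
        (1 / 2) * Real.log ((1 / 2) /
          ((1 - κ * Real.sqrt t₀) * pTwo t₀ ((1 - κ * Real.sqrt t₀) * x)))) ≤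
      1 / (3 * t₀ * (1 - κ * Real.sqrt t₀)) +
        Real.log (Real.sqrt t₀ / (1 - κ * Real.sqrt t₀)) +
        Real.log (2 * Real.sqrt (2 * Real.pi)) := by
  obtain ⟨ht, ht1⟩ := ht₀
  have hδ : κ * Real.sqrt t₀ < 1 := by
    rw [lt_div_iff₀ (by positivity)] at ht1
    have h : (κ * Real.sqrt t₀) ^ 2 < 1 := by
      rw [mul_pow, Real.sq_sqrt ht.le]
      linarith
    nlinarith [mul_nonneg hκ.le (Real.sqrt_nonneg t₀)]
  have hδ0 : 0 < κ * Real.sqrt t₀ := mul_pos hκ (Real.sqrt_pos.2 ht)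
  obtain ⟨a, hadef⟩ : ∃ a, a = 1 - κ * Real.sqrt t₀ := ⟨_, rfl⟩
  rw [← hadef]
  have ha : 0 < a := by linarith
  have ha1 : a < 1 := by linarith
  set C := Real.log (Real.sqrt (2 * Real.pi)) + Real.log (Real.sqrt t₀ / a) with hC
  have hcont : Continuous fun x : ℝ =>
      (1 / 2) * Real.log ((1 / 2) / (a * pTwo t₀ (a * x))) := by
    have hq : ∀ x, 0 < a * pTwo t₀ (a * x) := fun x => mul_pos ha (pTwo_pos ht _)
    have hp : Continuous fun x => a * pTwo t₀ (a * x) :=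
      continuous_const.mul ((continuous_pTwo t₀).comp (continuous_const.mul continuous_id))
    exact continuous_const.mul ((continuous_const.div hp fun x => (hq x).ne').log
      fun x => (div_pos (by norm_num) (hq x)).ne')
  have hint : ∫ x in (-1 : ℝ)..1,
      ((1 / 2) * C + 1 / (4 * t₀) + (a ^ 2 - 2 * a) / (4 * t₀) * x ^ 2) =
        C + (3 + (a ^ 2 - 2 * a)) / (6 * t₀) := by
    rw [intervalIntegral.integral_add (by simp)
      (Continuous.intervalIntegrable (by fun_prop) _ _),
      intervalIntegral.integral_const, intervalIntegral.integral_const_mul, integral_pow]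
    simp only [smul_eq_mul]
    field_simp
    norm_num
    ring
  have hpoly : (3 + (a ^ 2 - 2 * a)) / (6 * t₀) ≤ 1 / (3 * t₀ * a) := by
    rw [div_le_div_iff₀ (by positivity) (by positivity)]
    have h : a * (3 + (a ^ 2 - 2 * a)) ≤ 2 := by
      nlinarith [mul_nonneg (sub_nonneg.2 ha1.le) (by nlinarith [sq_nonneg a] : 0 ≤ a ^ 2 - a + 2)]
    nlinarith [mul_le_mul_of_nonneg_left h ht.le]
  have hlog2 : Real.log (2 * Real.sqrt (2 * Real.pi)) =
      Real.log 2 + Real.log (Real.sqrt (2 * Real.pi)) :=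
    Real.log_mul (by norm_num) (by positivity)
  have hmono : ∫ x in (-1 : ℝ)..1, (1 / 2) * Real.log ((1 / 2) / (a * pTwo t₀ (a * x))) ≤
      ∫ x in (-1 : ℝ)..1,
        ((1 / 2) * C + 1 / (4 * t₀) + (a ^ 2 - 2 * a) / (4 * t₀) * x ^ 2) := by
    refine intervalIntegral.integral_mono_on (by norm_num) (hcont.intervalIntegrable _ _)
      (Continuous.intervalIntegrable (by fun_prop) _ _) fun x hx => ?_
    have h := log_ratio_le ht ha hx
    have e : (1 / 2) * C + 1 / (4 * t₀) + (a ^ 2 - 2 * a) / (4 * t₀) * x ^ 2 =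
        (1 / 2) * (C + (1 + (a ^ 2 - 2 * a) * x ^ 2) / (2 * t₀)) := by
      field_simp
      ring
    rw [e]
    linarith
  rw [integral_Icc_eq_integral_Ioc, ← intervalIntegral.integral_of_le (by norm_num), hlog2]
  linarith [Real.log_pos (by norm_num : (1 : ℝ) < 2)]
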